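/- Let K be an algebraically closed field of characteristic p ≥ 5, and let λ₁, λ₂, λ₃, μ₁, μ₂, μ₃ ∈ K with f(x,y,z) = λ₁xyz + λ₂yzx + λ₃zxy + μ₁zyx + μ₂xzy + μ₃yxz. Then there exists a natural number k ≥ 1 such that for every natural number n ≥ 4 with n coprime to pᵏ − 1, the image of f in Mₙ(K), i.e. { f(a,b,c) : a, b, c ∈ Mₙ(K) }, is a K-vector subspace of Mₙ(K). -/

import Mathlib

/-- The value at `(a, b, c)` of a multilinear noncommutative polynomial of degree three. -/
def cubicEval {K A : Type*} [CommSemiring K] [Semiring A] [Algebra K A]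
    (l1 l2 l3 m1 m2 m3 : K) (a b c : A) : A :=
  l1 • (a * b * c) + l2 • (b * c * a) + l3 • (c * a * b)
    + m1 • (c * b * a) + m2 • (a * c * b) + m3 • (b * a * c)

/-- The cyclic shift matrix. -/
def cyclicShift (n : ℕ) (K : Type*) [Zero K] [One K] : Matrix (ZMod n) (ZMod n) K :=
  Matrix.of fun i j => if j = i + 1 then 1 else 0

section Shift

variable {n : ℕ} [NeZero n] {K : Type*}

theorem cyclicShift_mul_apply [Semiring K] (A : Matrix (ZMod n) (ZMod n) K) (i j : ZMod n) :
    (cyclicShift n K * A) i j = A (i + 1) j := by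
  simp [cyclicShift, Matrix.mul_apply]

theorem mul_cyclicShift_apply [Semiring K] (A : Matrix (ZMod n) (ZMod n) K) (i j : ZMod n) :
    (A * cyclicShift n K) i j = A i (j - 1) := by
  simp [cyclicShift, Matrix.mul_apply, ← sub_eq_iff_eq_add]

theorem cyclicShift_transpose_mul [Semiring K] :
    (cyclicShift n K).transpose * cyclicShift n K = 1 := by
  ext i j
  rw [mul_cyclicShift_apply]
  simp [cyclicShift, Matrix.one_apply]

theorem cyclicShift_mul_transpose [Semiring K] :
    cyclicShift n K * (cyclicShift n K).transpose = 1 := by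
  ext i j
  rw [cyclicShift_mul_apply]
  simp [cyclicShift, Matrix.one_apply]

theorem cubicEval_diagonal_cyclicShift_apply [CommRing K] (l1 l2 l3 m1 m2 m3 : K)
    (d : ZMod n → K) (z : Matrix (ZMod n) (ZMod n) K) (i j : ZMod n) :
    cubicEval l1 l2 l3 m1 m2 m3 (Matrix.diagonal d) (cyclicShift n K) z i j =
      (l1 * d i + l2 * d j + m3 * d (i + 1)) * z (i + 1) j
        + (l3 * d (j - 1) + m1 * d j + m2 * d i) * z i (j - 1) := by
  simp only [cubicEval, mul_assoc, Matrix.add_apply, Matrix.smul_apply, Matrix.diagonal_mul,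
    cyclicShift_mul_apply, smul_eq_mul]
  simp only [← mul_assoc, Matrix.mul_diagonal, mul_cyclicShift_apply]
  ring

theorem ZMod.prod_range_add [CommMonoid K] (f : ZMod n → K) (i : ZMod n) :
    ∏ k ∈ Finset.range n, f (i + k) = ∏ j, f j := by
  refine Finset.prod_bij (fun k _ => i + (k : ZMod n)) (by simp) ?_ ?_ (by simp)
  · intro a ha b hb h
    have := congrArg ZMod.val (add_left_cancel h)
    rwa [ZMod.val_cast_of_lt (Finset.mem_range.1 ha),
      ZMod.val_cast_of_lt (Finset.mem_range.1 hb)] at this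
  · intro b _
    exact ⟨(b - i).val, Finset.mem_range.2 (ZMod.val_lt _), by simp⟩

theorem exists_cyclic_bidiagonal_solution [Field K] (hn : Odd n) (P Q : ZMod n → K)
    (h : ∏ i, P i + ∏ i, Q i ≠ 0) (r : ZMod n → K) :
    ∃ u : ZMod n → K, ∀ i, P i * u (i + 1) + Q i * u i = r i := by
  let L : (ZMod n → K) →ₗ[K] (ZMod n → K) :=
    { toFun := fun u i => P i * u (i + 1) + Q i * u i
      map_add' := fun u v => by ext i; simp; ring
      map_smul' := fun c u => by ext i; simp; ring }
  have hL : Function.Injective L := by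
    rw [← LinearMap.ker_eq_bot, LinearMap.ker_eq_bot']
    intro u hu
    have hu' : ∀ i, P i * u (i + 1) = -Q i * u i := fun i => by
      have : P i * u (i + 1) + Q i * u i = 0 := congrFun hu i
      linear_combination this
    ext i
    have key : ∀ k : ℕ, (∏ j ∈ Finset.range k, P (i + j)) * u (i + k)
        = (∏ j ∈ Finset.range k, -Q (i + j)) * u i := by
      intro k
      induction k with
      | zero => simp
      | succ k ih =>
        rw [Finset.prod_range_succ, Finset.prod_range_succ]
        have := hu' (i + k)
        push_cast
        rw [← add_assoc]
        linear_combination (∏ j ∈ Finset.range k, P (i + j)) * this - Q (i + k) * ih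
    have := key n
    rw [ZMod.prod_range_add P, ZMod.prod_range_add (fun j => -Q j)] at this
    simp only [CharP.cast_eq_zero, add_zero, Finset.prod_neg, Finset.card_univ, ZMod.card,
      hn.neg_one_pow] at this
    have h' : (∏ i, P i + ∏ i, Q i) * u i = 0 := by linear_combination this
    simpa [h] using h'
  obtain ⟨u, hu⟩ := LinearMap.injective_iff_surjective.1 hL r
  exact ⟨u, congrFun hu⟩

theorem exists_cubicEval_eq_of_prod_add_prod_ne_zero [Field K] (hn : Odd n)
    (l1 l2 l3 m1 m2 m3 : K) (d : ZMod n → K) (T : Matrix (ZMod n) (ZMod n) K)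
    (h : ∀ m : ZMod n, (∀ i, T i (i + m) = 0) ∨
      ∏ i, (l1 * d i + l2 * d (i + m) + m3 * d (i + 1))
        + ∏ i, (l3 * d (i + m - 1) + m1 * d (i + m) + m2 * d i) ≠ 0) :
    ∃ a b c, T = cubicEval l1 l2 l3 m1 m2 m3 a b c := by
  have hu : ∀ m : ZMod n, ∃ u : ZMod n → K, ∀ i,
      (l1 * d i + l2 * d (i + m) + m3 * d (i + 1)) * u (i + 1)
        + (l3 * d (i + m - 1) + m1 * d (i + m) + m2 * d i) * u i = T i (i + m) := by
    intro m
    rcases h m with h0 | h0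
    · exact ⟨0, fun i => by simp [h0]⟩
    · exact exists_cyclic_bidiagonal_solution hn _ _ h0 _
  choose u hu using hu
  refine ⟨Matrix.diagonal d, cyclicShift n K, Matrix.of fun i j => u (j - i + 1) i, ?_⟩
  ext i j
  rw [cubicEval_diagonal_cyclicShift_apply]
  have := hu (j - i) i
  simp only [add_sub_cancel] at this
  simp only [Matrix.of_apply, ← this]
  ring_nf

end Shift

section Generic

theorem ZMod.natCast_ne_natCast {n a b : ℕ} (ha : a < n) (hb : b < n) (hab : a ≠ b) :
    (a : ZMod n) ≠ b := fun h => hab (by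
  simpa [ZMod.val_cast_of_lt ha, ZMod.val_cast_of_lt hb] using congrArg ZMod.val h)

theorem exists_injective_of_infinite (ι K : Type*) [Finite ι] [Infinite K] :
    ∃ d : ι → K, Function.Injective d :=
  ⟨_, ((Finite.equivFin ι).toEmbedding.trans
    (Fin.valEmbedding.trans (Infinite.natEmbedding K))).injective⟩

theorem exists_prod_add_prod_ne_zero {ι K V : Type*} [Fintype ι] [Field K] [Infinite K]
    [AddCommGroup V] [Module K V] (P Q : ι → Module.Dual K V) (i₀ : ι)
    (h : ∀ i, ∃ v, Q i₀ v = 0 ∧ P i v ≠ 0) : ∃ v, ∏ i, P i v + ∏ i, Q i v ≠ 0 := by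
  obtain ⟨v, hv, hP⟩ := Module.Dual.exists_forall_mem_ne_zero_of_forall_exists
    (LinearMap.ker (Q i₀)) P h
  refine ⟨v, ?_⟩
  rw [Finset.prod_eq_zero (f := fun i => Q i v) (Finset.mem_univ i₀) hv, add_zero]
  exact Finset.prod_ne_zero_iff.2 fun i _ => hP i

/-- Up to sign, the determinant of `z ↦ cubicEval l1 l2 l3 m1 m2 m3 (diagonal d) shift z` on the
matrices supported on a cyclic diagonal, with values on the `m`-th cyclic diagonal (`n` odd). -/
def cyclicDet {n : ℕ} [NeZero n] {R : Type*} [CommRing R] (l1 l2 l3 m1 m2 m3 : R) (m : ZMod n)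
    (d : ZMod n → R) : R :=
  ∏ i, (l1 * d i + l2 * d (i + m) + m3 * d (i + 1))
    + ∏ i, (l3 * d (i + m - 1) + m1 * d (i + m) + m2 * d i)

variable {n : ℕ} [NeZero n] {K : Type*} [Field K]

theorem exists_cyclicDet_ne_zero_and [Infinite K] {l1 l2 l3 m1 m2 m3 : K} {m m' : ZMod n}
    (h : ∃ d, cyclicDet l1 l2 l3 m1 m2 m3 m d ≠ 0)
    (h' : ∃ d, cyclicDet l1 l2 l3 m1 m2 m3 m' d ≠ 0) :
    ∃ d, cyclicDet l1 l2 l3 m1 m2 m3 m d ≠ 0 ∧ cyclicDet l1 l2 l3 m1 m2 m3 m' d ≠ 0 := by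
  let p : ZMod n → MvPolynomial (ZMod n) K := fun m =>
    cyclicDet (.C l1) (.C l2) (.C l3) (.C m1) (.C m2) (.C m3) m .X
  have hp : ∀ m d, MvPolynomial.eval d (p m) = cyclicDet l1 l2 l3 m1 m2 m3 m d := by
    intro m d
    simp [p, cyclicDet]
  by_contra! hcon
  have h0 : p m * p m' = 0 := MvPolynomial.funext fun d => by
    rw [map_mul, map_zero, hp, hp, mul_eq_zero]
    by_cases h0 : cyclicDet l1 l2 l3 m1 m2 m3 m d = 0
    · exact Or.inl h0
    · exact Or.inr (hcon d h0)
  obtain ⟨d, hd⟩ := h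
  obtain ⟨d', hd'⟩ := h'
  rcases mul_eq_zero.1 h0 with h0 | h0
  · exact hd (by rw [← hp, h0, map_zero])
  · exact hd' (by rw [← hp, h0, map_zero])

theorem exists_prod_add_prod_ne_zero_of_add_ne_zero [Infinite K] (hn : 3 ≤ n) {A B C D a : K}
    (ha : a ≠ 0) (hAB : A + B = a) (hCD : C + D = -a) (hAC : A + C ≠ 0)
    (hBC : ¬(B = 0 ∧ C = 0)) (hAD : ¬(A = 0 ∧ D = 0)) :
    ∃ d : ZMod n → K, ∏ i, (A * d i + B * d (i + 1)) + ∏ i, (C * d i + D * d (i + 1)) ≠ 0 := by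
  have h10 : (1 : ZMod n) ≠ 0 := by
    simpa using ZMod.natCast_ne_natCast (n := n) (a := 1) (b := 0) (by lia) (by lia) (by lia)
  have h20 : (1 + 1 : ZMod n) ≠ 0 := by
    simpa [one_add_one_eq_two] using
      ZMod.natCast_ne_natCast (n := n) (a := 2) (b := 0) (by lia) (by lia) (by lia)
  let F : K → K → ZMod n → Module.Dual K (ZMod n → K) := fun A B i =>
    A • LinearMap.proj i + B • LinearMap.proj (i + 1)
  suffices h : ∀ i, ∃ v, F C D 0 v = 0 ∧ F A B i v ≠ 0 by
    simpa [F] using exists_prod_add_prod_ne_zero (F A B) (F C D) 0 h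
  have hF : ∀ A B i v, F A B i v = A * v i + B * v (i + 1) := fun _ _ _ _ => by simp [F]
  simp only [hF, zero_add]
  set w : ZMod n → K := Pi.single 0 D - Pi.single 1 C with hw
  have w0 : w 0 = D := by simp [hw, h10.symm]
  have w1 : w 1 = -C := by simp [hw, h10]
  have hww : C * w 0 + D * w 1 = 0 := by rw [w0, w1]; ring
  have hdet : A * D - B * C ≠ 0 := by
    have : A * D - B * C = -(a * (A + C)) := by
      linear_combination A * hCD - C * hAB
    rw [this]
    exact neg_ne_zero.2 (mul_ne_zero ha hAC)
  intro i
  by_cases hi0 : i = 0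
  · subst hi0
    refine ⟨w, hww, ?_⟩
    rw [zero_add, w0, w1]
    convert hdet using 1
    ring
  by_cases hi1 : i = 1
  · subst hi1
    by_cases hB : B = 0
    · refine ⟨w, hww, ?_⟩
      have hA : A ≠ 0 := by rintro rfl; apply ha; rw [← hAB, hB, add_zero]
      have hC : C ≠ 0 := fun h => hBC ⟨hB, h⟩
      simp [w1, hB, hA, hC]
    · refine ⟨Pi.single (1 + 1) 1, ?_, ?_⟩
      · simp [h20.symm, h10]
      · simp [h10, hB]
  by_cases hi2 : i + 1 = 0
  · by_cases hA : A = 0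
    · refine ⟨w, hww, ?_⟩
      have hD : D ≠ 0 := fun h => hAD ⟨hA, h⟩
      have hB : B ≠ 0 := by rintro rfl; apply ha; rw [← hAB, hA, add_zero]
      simp [hi2, w0, hA, hB, hD]
    · refine ⟨Pi.single i 1, ?_, ?_⟩
      · simp [Ne.symm hi0, Ne.symm hi1]
      · simp [hA, h10]
  · have hi3 : i + 1 ≠ 1 := by simpa using hi0
    by_cases hA : A = 0
    · have hB : B ≠ 0 := by rintro rfl; apply ha; rw [← hAB, hA, add_zero]
      refine ⟨Pi.single (i + 1) 1, ?_, ?_⟩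
      · simp only [Pi.single_apply, Ne.symm hi2, Ne.symm hi3]; simp
      · simp [hA, hB]
    · refine ⟨Pi.single i 1, ?_, ?_⟩
      · simp [Ne.symm hi0, Ne.symm hi1]
      · simp [hA, h10]

theorem exists_prod_add_prod_ne_zero_of_add_eq_zero [Infinite K] (hn : 2 ≤ n) {A B C D : K}
    (hAB : A + B = 0) (hCD : C + D = 0) (hAC : A ^ n + C ^ n ≠ 0) :
    ∃ d : ZMod n → K, ∏ i, (A * d i + B * d (i + 1)) + ∏ i, (C * d i + D * d (i + 1)) ≠ 0 := by
  obtain ⟨d, hd⟩ := exists_injective_of_infinite (ZMod n) K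
  refine ⟨d, ?_⟩
  have : Nontrivial (ZMod n) := ZMod.nontrivial_iff.2 (by lia)
  have h : ∀ {A B : K}, A + B = 0 →
      ∏ i, (A * d i + B * d (i + 1)) = A ^ n * ∏ i, (d i - d (i + 1)) := by
    intro A B h
    rw [eq_neg_of_add_eq_zero_right h]
    simp [← mul_sub, ← sub_eq_add_neg, Finset.prod_mul_distrib]
  rw [h hAB, h hCD, ← add_mul]
  refine mul_ne_zero hAC (Finset.prod_ne_zero_iff.2 fun i _ => sub_ne_zero.2 fun h => ?_)
  simpa using hd h

theorem cyclicDet_zero (l1 l2 l3 m1 m2 m3 : K) (d : ZMod n → K) :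
    cyclicDet l1 l2 l3 m1 m2 m3 0 d =
      ∏ i, ((l1 + l2) * d i + m3 * d (i + 1)) + ∏ i, (l3 * d i + (m1 + m2) * d (i + 1)) := by
  rw [cyclicDet, ← Equiv.prod_comp (Equiv.addRight (1 : ZMod n))
    (fun i => l3 * d (i + 0 - 1) + m1 * d (i + 0) + m2 * d i)]
  congr 1 <;> refine Finset.prod_congr rfl fun i _ => ?_ <;> simp <;> ring

theorem cyclicDet_one (l1 l2 l3 m1 m2 m3 : K) (d : ZMod n → K) :
    cyclicDet l1 l2 l3 m1 m2 m3 1 d =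
      ∏ i, (l1 * d i + (l2 + m3) * d (i + 1)) + ∏ i, ((l3 + m2) * d i + m1 * d (i + 1)) := by
  rw [cyclicDet]
  congr 1 <;> refine Finset.prod_congr rfl fun i _ => ?_
  · ring
  · rw [add_sub_cancel_right]
    ring

end Generic

section Bidiagonal

variable {n : ℕ} [NeZero n] {K : Type*} [Field K]

/-- Every bidiagonal matrix is a value of the polynomial. -/
def AttainsBidiagonal (n : ℕ) [NeZero n] {K : Type*} [Field K] (l1 l2 l3 m1 m2 m3 : K) : Prop :=
  ∀ T : Matrix (ZMod n) (ZMod n) K, (∀ i j, j ≠ i → j ≠ i + 1 → T i j = 0) →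
    ∃ a b c, T = cubicEval l1 l2 l3 m1 m2 m3 a b c

theorem AttainsBidiagonal.rotate {l1 l2 l3 m1 m2 m3 : K}
    (h : AttainsBidiagonal n l3 l1 l2 m3 m1 m2) : AttainsBidiagonal n l1 l2 l3 m1 m2 m3 := by
  intro T hT
  obtain ⟨a, b, c, rfl⟩ := h T hT
  refine ⟨b, c, a, ?_⟩
  simp only [cubicEval]
  abel

theorem AttainsBidiagonal.swap {l1 l2 l3 m1 m2 m3 : K}
    (h : AttainsBidiagonal n m3 m2 m1 l3 l2 l1) : AttainsBidiagonal n l1 l2 l3 m1 m2 m3 := by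
  intro T hT
  obtain ⟨a, b, c, rfl⟩ := h T hT
  refine ⟨b, a, c, ?_⟩
  simp only [cubicEval]
  abel

theorem attainsBidiagonal_of_cyclicDet [Infinite K] (hn : Odd n) {l1 l2 l3 m1 m2 m3 : K}
    (h0 : ∃ d : ZMod n → K, cyclicDet l1 l2 l3 m1 m2 m3 0 d ≠ 0)
    (h1 : ∃ d : ZMod n → K, cyclicDet l1 l2 l3 m1 m2 m3 1 d ≠ 0) :
    AttainsBidiagonal n l1 l2 l3 m1 m2 m3 := by
  intro T hT
  obtain ⟨d, hd0, hd1⟩ := exists_cyclicDet_ne_zero_and h0 h1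
  refine exists_cubicEval_eq_of_prod_add_prod_ne_zero hn _ _ _ _ _ _ d T fun m => ?_
  by_cases hm0 : m = 0
  · subst hm0
    exact Or.inr hd0
  by_cases hm1 : m = 1
  · subst hm1
    exact Or.inr hd1
  · exact Or.inl fun i => hT _ _ (by simpa using hm0) (by simpa using hm1)

theorem attainsBidiagonal_of_add_eq_zero [Infinite K] (hn : Odd n) (hn2 : 2 ≤ n)
    {l1 l2 l3 m1 m2 m3 : K} (hl : l1 + l2 + m3 = 0) (hm : m1 + m2 + l3 = 0)
    (h3 : l3 ^ n ≠ m3 ^ n) (h1 : l1 ^ n ≠ m1 ^ n) : AttainsBidiagonal n l1 l2 l3 m1 m2 m3 := by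
  refine attainsBidiagonal_of_cyclicDet hn ?_ ?_
  · simp only [cyclicDet_zero]
    refine exists_prod_add_prod_ne_zero_of_add_eq_zero hn2 hl (by linear_combination hm) ?_
    rw [eq_neg_of_add_eq_zero_left hl, hn.neg_pow, neg_add_eq_sub]
    exact sub_ne_zero.2 h3
  · simp only [cyclicDet_one]
    refine exists_prod_add_prod_ne_zero_of_add_eq_zero hn2 (by linear_combination hl)
      (by linear_combination hm) ?_
    rw [eq_neg_of_add_eq_zero_left (show l3 + m2 + m1 = 0 by linear_combination hm), hn.neg_pow,
      ← sub_eq_add_neg]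
    exact sub_ne_zero.2 h1

theorem attainsBidiagonal_of_add_ne_zero [Infinite K] (hn : Odd n) (hn3 : 3 ≤ n)
    {l1 l2 l3 m1 m2 m3 : K} (hs : l1 + l2 + l3 + m1 + m2 + m3 = 0) (ha : l1 + l2 + m3 ≠ 0)
    (hc : l1 + l3 + m2 ≠ 0) (hS : l1 + l2 + l3 ≠ 0)
    (h1 : ¬(m3 = 0 ∧ l3 = 0)) (h2 : ¬(l1 + l2 = 0 ∧ m1 + m2 = 0))
    (h3 : ¬(l2 + m3 = 0 ∧ l3 + m2 = 0)) (h4 : ¬(l1 = 0 ∧ m1 = 0)) :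
    AttainsBidiagonal n l1 l2 l3 m1 m2 m3 := by
  refine attainsBidiagonal_of_cyclicDet hn ?_ ?_
  · simp only [cyclicDet_zero]
    exact exists_prod_add_prod_ne_zero_of_add_ne_zero hn3 ha rfl (by linear_combination hs) hS h1 h2
  · simp only [cyclicDet_one]
    refine exists_prod_add_prod_ne_zero_of_add_ne_zero hn3 ha (by ring) (by linear_combination hs)
      (by rwa [← add_assoc]) h3 h4

theorem exists_eq_diagonal_commutator {ι : Type*} [Fintype ι] [DecidableEq ι] {d : ι → K}
    (hd : Function.Injective d) (T : Matrix ι ι K) (hT : ∀ i, T i i = 0) :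
    ∃ x, T = Matrix.diagonal d * x - x * Matrix.diagonal d := by
  refine ⟨Matrix.of fun i j => T i j / (d i - d j), ?_⟩
  ext i j
  rw [Matrix.sub_apply, Matrix.diagonal_mul, Matrix.mul_diagonal, Matrix.of_apply]
  by_cases hij : i = j
  · subst hij
    simp [hT]
  · have : d i - d j ≠ 0 := sub_ne_zero.2 fun h => hij (hd h)
    field_simp

theorem attainsBidiagonal_sub_reverse [Infinite K] (hn3 : 3 ≤ n) {t : K} (ht : t ≠ 0) :
    AttainsBidiagonal n t 0 0 (-t) 0 0 := by
  intro T hT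
  have h10 : (1 : ZMod n) ≠ 0 := by
    simpa using ZMod.natCast_ne_natCast (n := n) (a := 1) (b := 0) (by lia) (by lia) (by lia)
  have h20 : (1 + 1 : ZMod n) ≠ 0 := by
    simpa [one_add_one_eq_two] using
      ZMod.natCast_ne_natCast (n := n) (a := 2) (b := 0) (by lia) (by lia) (by lia)
  obtain ⟨d, hd⟩ := exists_injective_of_infinite (ZMod n) K
  obtain ⟨x, hx⟩ := exists_eq_diagonal_commutator hd (cyclicShift n K * T) fun i => by
    rw [cyclicShift_mul_apply]
    exact hT _ _ (by simpa using h10) (by simpa [add_assoc] using h20)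
  set s := cyclicShift n K
  refine ⟨t⁻¹ • (s.transpose * Matrix.diagonal d), s, s.transpose * x, ?_⟩
  have h1 : ∀ y, s * (s.transpose * y) = y := fun y => by
    rw [← mul_assoc, cyclicShift_mul_transpose, one_mul]
  have h2 : ∀ y, s.transpose * (s * y) = y := fun y => by
    rw [← mul_assoc, cyclicShift_transpose_mul, one_mul]
  rw [← h2 T, hx]
  simp [cubicEval, mul_assoc, h1, mul_add, smul_smul, ht, sub_eq_add_neg]

theorem exists_cyclicDet_neg_one_ne_zero [Infinite K] (hn4 : 4 ≤ n) (h2 : (2 : K) ≠ 0) {t : K}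
    (ht : t ≠ 0) : ∃ d : ZMod n → K, cyclicDet t t t (-t) (-t) (-t) (-1) d ≠ 0 := by
  have h10 : (1 : ZMod n) ≠ 0 := by
    simpa using ZMod.natCast_ne_natCast (n := n) (a := 1) (b := 0) (by lia) (by lia) (by lia)
  have h20 : (1 + 1 : ZMod n) ≠ 0 := by
    simpa [one_add_one_eq_two] using
      ZMod.natCast_ne_natCast (n := n) (a := 2) (b := 0) (by lia) (by lia) (by lia)
  have h30 : (1 + 1 + 1 : ZMod n) ≠ 0 := by
    have := ZMod.natCast_ne_natCast (n := n) (a := 3) (b := 0) (by lia) (by lia) (by lia)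
    intro h
    apply this
    linear_combination h
  let P : ZMod n → Module.Dual K (ZMod n → K) := fun i =>
    t • (.proj i + .proj (i - 1) - .proj (i + 1) : (ZMod n → K) →ₗ[K] K)
  let Q : ZMod n → Module.Dual K (ZMod n → K) := fun i =>
    t • (.proj (i - 1 - 1) - .proj (i - 1) - .proj i : (ZMod n → K) →ₗ[K] K)
  suffices h : ∀ i, ∃ v, Q 1 v = 0 ∧ P i v ≠ 0 by
    obtain ⟨v, hv⟩ := exists_prod_add_prod_ne_zero P Q 1 h
    refine ⟨v, ?_⟩
    convert hv using 1
    rw [cyclicDet]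
    congr 1 <;> refine Finset.prod_congr rfl fun i _ => ?_ <;>
      simp [P, Q, ← sub_eq_add_neg] <;> ring
  have hP : ∀ i v, P i v = t * (v i + v (i - 1) - v (i + 1)) := fun _ _ => by simp [P]
  have hQ : ∀ v, Q 1 v = t * (v (-1) - v 0 - v 1) := fun _ => by simp [Q]
  simp only [hP, hQ]
  have e1 : (-1 : ZMod n) ≠ 0 := neg_ne_zero.2 h10
  have e2 : (-1 : ZMod n) ≠ 1 := fun h => h20 (by linear_combination -h)
  intro i
  by_cases hi0 : i = 0
  · subst hi0
    refine ⟨Pi.single (-1) 1 + Pi.single 0 1, ?_, ?_⟩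
    · simp [h10, e1, e1.symm, e2.symm]
    · simp [h10, e1, e1.symm, e2.symm, ht, one_add_one_eq_two, h2]
  by_cases hi1 : i = 1
  · subst hi1
    have e3 : (1 + 1 : ZMod n) ≠ -1 := fun h => h30 (by linear_combination h)
    have e4 : (1 + 1 : ZMod n) ≠ 1 := by simpa using h10
    refine ⟨Pi.single (1 + 1) 1, ?_, ?_⟩
    · simp [h20.symm, e3.symm, e4.symm]
    · simp [h20.symm, e4.symm, ht]
  by_cases hi2 : i = -1
  · subst hi2
    have e3 : (-1 - 1 : ZMod n) ≠ -1 := by simpa [sub_eq_add_neg] using h10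
    have e4 : (-1 - 1 : ZMod n) ≠ 0 := fun h => h20 (by linear_combination -h)
    have e5 : (-1 - 1 : ZMod n) ≠ 1 := fun h => h30 (by linear_combination -h)
    refine ⟨Pi.single (-1 - 1) 1, ?_, ?_⟩
    · simp [e3.symm, e4.symm, e5.symm]
    · simp [e3.symm, e4.symm, ht]
  · refine ⟨Pi.single i 1, ?_, ?_⟩
    · simp [Ne.symm hi0, Ne.symm hi1, Ne.symm hi2]
    · simp [h10, ht]

theorem attainsBidiagonal_standard [Infinite K] (hn : Odd n) (hn4 : 4 ≤ n) (h2 : (2 : K) ≠ 0)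
    (h3 : (3 : K) ≠ 0) {t : K} (ht : t ≠ 0) :
    AttainsBidiagonal n t t t (-t) (-t) (-t) := by
  intro T hT
  obtain ⟨d, hd0, hd1⟩ := exists_cyclicDet_ne_zero_and (n := n) (m := 0)
    (l1 := -t) (l2 := -t) (l3 := -t) (m1 := - -t) (m2 := - -t) (m3 := - -t)
    (by
      simp only [cyclicDet_zero]
      refine exists_prod_add_prod_ne_zero_of_add_ne_zero (a := -t) (by lia) (by simpa using ht)
        (by ring) (by ring) ?_ (by simp [ht]) ?_
      · rw [show -t + -t + -t = -(3 * t) by ring]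
        exact neg_ne_zero.2 (mul_ne_zero h3 ht)
      · rintro ⟨h, -⟩
        rw [show -t + -t = -(2 * t) by ring] at h
        exact neg_ne_zero.2 (mul_ne_zero h2 ht) h)
    (exists_cyclicDet_neg_one_ne_zero hn4 h2 (neg_ne_zero.2 ht))
  obtain ⟨a, b, c, habc⟩ := exists_cubicEval_eq_of_prod_add_prod_ne_zero hn _ _ _ _ _ _ d
    T.transpose fun m => by
      by_cases hm0 : m = 0
      · subst hm0
        exact Or.inr hd0
      by_cases hm1 : m = -1
      · subst hm1
        exact Or.inr hd1
      · refine Or.inl fun i => hT _ _ (by simpa [eq_comm] using hm0) fun h => hm1 ?_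
        linear_combination -h
  refine ⟨a.transpose, b.transpose, c.transpose, ?_⟩
  rw [← T.transpose_transpose, habc]
  simp only [cubicEval, Matrix.transpose_add, Matrix.transpose_smul, Matrix.transpose_mul,
    mul_assoc]
  simp only [neg_neg]
  abel

end Bidiagonal

section CaseAnalysis

variable {n : ℕ} [NeZero n] {K : Type*} [Field K] [Infinite K]

theorem attainsBidiagonal_of_first_eq_zero (hn : Odd n) (hn2 : 2 ≤ n) {l1 l2 l3 m1 m2 m3 : K}
    (hs : l1 + l2 + l3 + m1 + m2 + m3 = 0) (hS : l1 + l2 + l3 ≠ 0)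
    (h1 : l1 ^ n = m1 ^ n → l1 = m1) (h2 : l2 ^ n = m2 ^ n → l2 = m2)
    (h3 : l3 ^ n = m3 ^ n → l3 = m3) (ha : l1 + l2 + m3 = 0) :
    AttainsBidiagonal n l1 l2 l3 m1 m2 m3 := by
  by_cases hc : l1 + l3 + m2 = 0
  · refine AttainsBidiagonal.rotate (attainsBidiagonal_of_add_eq_zero hn hn2
      (by linear_combination hc) (by linear_combination hs - hc) (fun h => hS ?_) (fun h => hS ?_))
    · linear_combination hc + h2 h
    · linear_combination ha + h3 h
  · refine attainsBidiagonal_of_add_eq_zero hn hn2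
      (by linear_combination ha) (by linear_combination hs - ha) (fun h => hS ?_) (fun h => hc ?_)
    · linear_combination ha + h3 h
    · linear_combination hs - ha + h1 h

theorem attainsBidiagonal_antisymm_of_ne (hn : Odd n) (hn3 : 3 ≤ n) {A B C : K}
    (hS : A + B + C ≠ 0) (ha : A + B - C ≠ 0) (hc : A + C - B ≠ 0)
    (hA : A ≠ 0) (hC : C ≠ 0) (hAB : A + B ≠ 0) (hBC : B ≠ C) :
    AttainsBidiagonal n A B C (-A) (-B) (-C) :=
  attainsBidiagonal_of_add_ne_zero hn hn3 (by ring) (by rwa [← sub_eq_add_neg])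
    (by rwa [← sub_eq_add_neg]) hS (by simp [hC]) (fun h => hAB h.1)
    (fun h => hBC (by linear_combination h.1)) (by simp [hA])

theorem attainsBidiagonal_antisymm_of_ne_zero (hn : Odd n) (hn3 : 3 ≤ n) {A B C : K}
    (hS : A + B + C ≠ 0) (ha : A + B - C ≠ 0) (hc : A + C - B ≠ 0)
    (hA : A ≠ 0) (hB : B ≠ 0) (hC : C ≠ 0) (hBC : B ≠ C) :
    AttainsBidiagonal n A B C (-A) (-B) (-C) := by
  by_cases hAB : A + B = 0
  · refine AttainsBidiagonal.swap (AttainsBidiagonal.rotate ?_)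
    have hAC : A + C ≠ 0 := fun h => hBC (by linear_combination hAB - h)
    simpa only [neg_neg] using attainsBidiagonal_antisymm_of_ne (A := -A) (B := -C) (C := -B)
      hn hn3 (fun h => hS (by linear_combination -h)) (fun h => hc (by linear_combination -h))
      (fun h => ha (by linear_combination -h)) (neg_ne_zero.2 hA) (neg_ne_zero.2 hB)
      (fun h => hAC (by linear_combination -h)) (fun h => hBC (neg_injective h).symm)
  · exact attainsBidiagonal_antisymm_of_ne hn hn3 hS ha hc hA hC hAB hBC

theorem attainsBidiagonal_antisymm (hn : Odd n) (hn4 : 4 ≤ n) (h2 : (2 : K) ≠ 0)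
    (h3 : (3 : K) ≠ 0) {A B C : K} (hS : A + B + C ≠ 0) (ha : A + B - C ≠ 0)
    (hb : B + C - A ≠ 0) (hc : A + C - B ≠ 0) :
    AttainsBidiagonal n A B C (-A) (-B) (-C) := by
  have hn3 : 3 ≤ n := by lia
  have hb' : C + B - A ≠ 0 := by rwa [add_comm C]
  have hc' : C + A - B ≠ 0 := by rwa [add_comm C]
  have ha' : B + A - C ≠ 0 := by rwa [add_comm B]
  have hS' : C + A + B ≠ 0 := by rwa [add_assoc, add_comm C]
  have hS'' : B + C + A ≠ 0 := by rwa [add_comm _ A, ← add_assoc]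
  by_cases hA : A = 0
  · subst hA
    by_cases hB : B = 0
    · subst hB
      simpa using (attainsBidiagonal_sub_reverse hn3 (by simpa using hS : C ≠ 0)).rotate
    by_cases hC : C = 0
    · subst hC
      simpa using (attainsBidiagonal_sub_reverse hn3 hB).rotate.rotate
    · exact (attainsBidiagonal_antisymm_of_ne hn hn3 hS' hc' hb' hC hB (by simpa)
        (Ne.symm hB)).rotate
  by_cases hC : C = 0
  · subst hC
    by_cases hB : B = 0
    · subst hB
      simpa using attainsBidiagonal_sub_reverse hn3 hA
    · exact (attainsBidiagonal_antisymm_of_ne hn hn3 hS'' hb ha' hB hA (by simpa)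
        (Ne.symm hA)).rotate.rotate
  by_cases hB : B = 0
  · subst hB
    exact attainsBidiagonal_antisymm_of_ne hn hn3 hS ha hc hA hC (by simpa) (Ne.symm hC)
  by_cases hBC : B = C
  · subst hBC
    by_cases hAB : A = B
    · subst hAB
      exact attainsBidiagonal_standard hn hn4 h2 h3 hA
    · exact (attainsBidiagonal_antisymm_of_ne_zero hn hn3 hS' hc' hb' hC hA hB hAB).rotate
  · exact attainsBidiagonal_antisymm_of_ne_zero hn hn3 hS ha hc hA hB hC hBC

theorem attainsBidiagonal_of_add_opposite_ne_zero (hn : Odd n) (hn3 : 3 ≤ n)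
    {l1 l2 l3 m1 m2 m3 : K} (hs : l1 + l2 + l3 + m1 + m2 + m3 = 0) (hS : l1 + l2 + l3 ≠ 0)
    (ha : l1 + l2 + m3 ≠ 0) (hc : l1 + l3 + m2 ≠ 0) (hp : l3 + m3 ≠ 0) (hq : l1 + m1 ≠ 0) :
    AttainsBidiagonal n l1 l2 l3 m1 m2 m3 :=
  attainsBidiagonal_of_add_ne_zero hn hn3 hs ha hc hS
    (fun h => hp (by linear_combination h.1 + h.2))
    (fun h => hp (by linear_combination hs - h.1 - h.2))
    (fun h => hq (by linear_combination hs - h.1 - h.2))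
    (fun h => hq (by linear_combination h.1 + h.2))

theorem attainsBidiagonal_of_sum_ne_zero (hn : Odd n) (hn4 : 4 ≤ n) (h2 : (2 : K) ≠ 0)
    (h3 : (3 : K) ≠ 0) {l1 l2 l3 m1 m2 m3 : K}
    (hs : l1 + l2 + l3 + m1 + m2 + m3 = 0) (hS : l1 + l2 + l3 ≠ 0)
    (hp1 : l1 ^ n = m1 ^ n → l1 = m1) (hp2 : l2 ^ n = m2 ^ n → l2 = m2)
    (hp3 : l3 ^ n = m3 ^ n → l3 = m3) :
    AttainsBidiagonal n l1 l2 l3 m1 m2 m3 := by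
  have hn2 : 2 ≤ n := by lia
  have hn3 : 3 ≤ n := by lia
  have hSm : m3 + m2 + m1 ≠ 0 := fun h => hS (by linear_combination hs - h)
  by_cases ha : l1 + l2 + m3 = 0
  · exact attainsBidiagonal_of_first_eq_zero hn hn2 hs hS hp1 hp2 hp3 ha
  by_cases hb : l2 + l3 + m1 = 0
  · exact (attainsBidiagonal_of_first_eq_zero hn hn2 (by linear_combination hs) hSm
      (fun h => (hp3 h.symm).symm) (fun h => (hp2 h.symm).symm) (fun h => (hp1 h.symm).symm)
      (by linear_combination hs - hb)).swap
  by_cases hc : l1 + l3 + m2 = 0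
  · exact (attainsBidiagonal_of_first_eq_zero hn hn2 (by linear_combination hs)
      (fun h => hS (by linear_combination h)) hp3 hp1 hp2 (by linear_combination hc)).rotate
  by_cases hp : l3 + m3 = 0
  · by_cases hq : l1 + m1 = 0
    · have e1 := eq_neg_of_add_eq_zero_right hq
      have e3 := eq_neg_of_add_eq_zero_right hp
      have e2 : m2 = -l2 := by linear_combination hs - hp - hq
      subst e1 e2 e3
      exact attainsBidiagonal_antisymm hn hn4 h2 h3 hS (by rwa [sub_eq_add_neg])
        (by rwa [sub_eq_add_neg]) (by rwa [sub_eq_add_neg])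
    · exact AttainsBidiagonal.rotate <| AttainsBidiagonal.rotate <|
        attainsBidiagonal_of_add_opposite_ne_zero hn hn3
          (by linear_combination hs) (fun h => hS (by linear_combination h)) hb
          (fun h => ha (by linear_combination h)) hq
          (fun h => hq (by linear_combination hs - hp - h))
  by_cases hq : l1 + m1 = 0
  · exact AttainsBidiagonal.rotate <|
      attainsBidiagonal_of_add_opposite_ne_zero hn hn3
        (by linear_combination hs) (fun h => hS (by linear_combination h))
        (fun h => hc (by linear_combination h)) (fun h => hb (by linear_combination h))
        (fun h => hp (by linear_combination hs - hq - h)) hp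
  · exact attainsBidiagonal_of_add_opposite_ne_zero hn hn3 hs hS ha hc hp hq

end CaseAnalysis

section Hollow

open Matrix

variable {K : Type*} [Field K] {ι : Type*} [Fintype ι] [DecidableEq ι]

/-- A square matrix is similar to a hollow one: some conjugate of it has zero diagonal. -/
def Matrix.SimilarToHollow (T : Matrix ι ι K) : Prop :=
  ∃ P Q : Matrix ι ι K, P * Q = 1 ∧ Q * P = 1 ∧ ∀ i, (P * T * Q) i i = 0

theorem Matrix.SimilarToHollow.of_conj {T P Q : Matrix ι ι K} (hPQ : P * Q = 1) (hQP : Q * P = 1)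
    (h : (P * T * Q).SimilarToHollow) : T.SimilarToHollow := by
  obtain ⟨R, S, hRS, hSR, h⟩ := h
  refine ⟨R * P, Q * S, ?_, ?_, fun i => ?_⟩
  · rw [Matrix.mul_assoc, ← Matrix.mul_assoc P, hPQ, Matrix.one_mul, hRS]
  · rw [Matrix.mul_assoc, ← Matrix.mul_assoc S, hSR, Matrix.one_mul, hQP]
  · simpa only [Matrix.mul_assoc] using h i

theorem Matrix.SimilarToHollow.of_submatrix {κ : Type*} [Fintype κ] [DecidableEq κ]
    {T : Matrix ι ι K} (e : κ ≃ ι) (h : (T.submatrix e e).SimilarToHollow) :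
    T.SimilarToHollow := by
  obtain ⟨P, Q, hPQ, hQP, h⟩ := h
  refine ⟨P.submatrix e.symm e.symm, Q.submatrix e.symm e.symm, ?_, ?_, fun i => ?_⟩
  · rw [submatrix_mul_equiv, hPQ, submatrix_one_equiv]
  · rw [submatrix_mul_equiv, hQP, submatrix_one_equiv]
  · have hT : T = (T.submatrix e e).submatrix e.symm e.symm := by simp
    rw [hT, submatrix_mul_equiv, submatrix_mul_equiv]
    exact h _

theorem Matrix.SimilarToHollow.fromBlocks₁₁ {κ : Type*} [Fintype κ] [DecidableEq κ]
    {A : Matrix ι ι K} (B : Matrix ι κ K) (C : Matrix κ ι K) {D : Matrix κ κ K}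
    (hA : A.SimilarToHollow) (hD : ∀ i, D i i = 0) :
    (fromBlocks A B C D).SimilarToHollow := by
  obtain ⟨P, Q, hPQ, hQP, h⟩ := hA
  refine ⟨fromBlocks P 0 0 1, fromBlocks Q 0 0 1, ?_, ?_, ?_⟩
  · simp [fromBlocks_multiply, hPQ]
  · simp [fromBlocks_multiply, hQP]
  · rintro (i | i) <;> simp [fromBlocks_multiply, h, hD]

theorem Matrix.exists_conj_apply_ne_zero {T : Matrix ι ι K} (hT : ∀ c : K, T ≠ c • 1) :
    ∃ P Q : Matrix ι ι K, P * Q = 1 ∧ Q * P = 1 ∧ ∃ i j, i ≠ j ∧ (P * T * Q) i j ≠ 0 := by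
  by_cases hd : ∃ i j, i ≠ j ∧ T i j ≠ 0
  · exact ⟨1, 1, by simp, by simp, by simpa using hd⟩
  push Not at hd
  have hij : ∃ i j, i ≠ j ∧ T i i ≠ T j j := by
    by_contra! h
    rcases isEmpty_or_nonempty ι with hι | ⟨⟨k⟩⟩
    · exact hT 0 (Subsingleton.elim _ _)
    refine hT (T k k) (Matrix.ext fun i j => ?_)
    by_cases hij : i = j
    · subst hij
      by_cases hik : i = k
      · simp [hik]
      · simp [h i k hik]
    · simp [hd i j hij, hij]
  obtain ⟨i, j, hij, hne⟩ := hij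
  refine ⟨transvection i j 1, transvection i j (-1), ?_, ?_, i, j, hij, ?_⟩
  · rw [transvection_mul_transvection_same _ _ hij]; simp
  · rw [transvection_mul_transvection_same _ _ hij]; simp
  · rw [mul_transvection_apply_same, transvection_mul_apply_same, transvection_mul_apply_same,
      hd i j hij, hd j i hij.symm]
    intro h
    exact hne (by linear_combination -h)

theorem Matrix.exists_mul_eq_and_sub_mul_ne_smul_one (B : Matrix ι ι K) {w : Matrix ι Unit K}
    {i k : ι} (hi : w i () ≠ 0) (hik : i ≠ k) (a : K) :
    ∃ u : Matrix Unit ι K, (u * w) () () = a ∧ ∀ c : K, B - w * u ≠ c • 1 := by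
  let u₀ : Matrix Unit ι K := Matrix.of fun _ => Pi.single i (a / w i ())
  let z : Matrix Unit ι K := Matrix.of fun _ => Pi.single k (w i ()) - Pi.single i (w k ())
  have hu₀ : (u₀ * w) () () = a := by
    simp [u₀, Matrix.mul_apply, Pi.single_apply, hi]
  have hz : (z * w) () () = 0 := by
    simp [z, Matrix.mul_apply, Pi.single_apply, sub_mul, Finset.sum_sub_distrib, mul_comm (w k ())]
  by_cases h : ∀ c : K, B - w * u₀ ≠ c • 1
  · exact ⟨u₀, hu₀, h⟩
  push Not at h
  obtain ⟨c, hc⟩ := h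
  refine ⟨u₀ + z, by rw [Matrix.add_mul, Matrix.add_apply, hu₀, hz, add_zero], fun d hd => ?_⟩
  rw [Matrix.mul_add, ← sub_sub, hc] at hd
  have := congrFun (congrFun hd i) k
  simp [z, Matrix.mul_apply, hik, hi] at this

theorem Matrix.similarToHollow_of_trace_eq_zero {T : Matrix ι ι K} (hT : ∀ c : K, T ≠ c • 1)
    (htr : T.trace = 0) : T.SimilarToHollow := by
  induction hn : Fintype.card ι generalizing ι with
  | zero =>
    have := Fintype.card_eq_zero_iff.1 hn
    exact absurd (Subsingleton.elim _ _) (hT 0)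
  | succ n ih =>
    obtain ⟨P, Q, hPQ, hQP, i, j, hij, hne⟩ := exists_conj_apply_ne_zero hT
    refine .of_conj hPQ hQP ?_
    let e : {x // x ≠ j} ⊕ Unit ≃ ι :=
      (Equiv.optionEquivSumPUnit _).symm.trans (Equiv.optionSubtypeNe j)
    refine .of_submatrix e ?_
    set M := (P * T * Q).submatrix e e with hM
    have hMtr : M.trace = 0 := by
      rw [← htr, ← Matrix.one_mul T, ← hQP, Matrix.mul_assoc, Matrix.trace_mul_comm Q]
      exact Equiv.sum_comp e fun x => (P * T * Q) x x
    have hw : M.toBlocks₁₂ ⟨i, hij⟩ () ≠ 0 := by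
      simpa [hM, toBlocks₁₂, e] using hne
    rw [← fromBlocks_toBlocks M] at hMtr ⊢
    generalize M.toBlocks₁₁ = B at *
    generalize M.toBlocks₁₂ = w at *
    generalize M.toBlocks₂₁ = v at *
    generalize M.toBlocks₂₂ = a at *
    have hconj : ∀ u : Matrix Unit {x // x ≠ j} K, (u * w) () () = - a () () →
        (B - w * u).SimilarToHollow → (fromBlocks B w v a).SimilarToHollow := by
      intro u hu h
      refine .of_conj (P := fromBlocks 1 0 u 1) (Q := fromBlocks 1 0 (-u) 1)
        (by simp [fromBlocks_multiply]) (by simp [fromBlocks_multiply]) ?_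
      simp only [fromBlocks_multiply, Matrix.one_mul, Matrix.zero_mul, Matrix.mul_one,
        Matrix.mul_zero, add_zero, zero_add, Matrix.mul_neg, ← sub_eq_add_neg]
      exact h.fromBlocks₁₁ _ _ (by simp [hu])
    have htr' : ∀ u : Matrix Unit {x // x ≠ j} K, (u * w) () () = - a () () →
        (B - w * u).trace = 0 := by
      intro u hu
      rw [Matrix.trace_sub, Matrix.trace_mul_comm w u, sub_eq_zero]
      simp only [Matrix.trace, Matrix.diag_apply, Fintype.sum_sum_type, fromBlocks_apply₁₁,
        fromBlocks_apply₂₂, Finset.univ_unique, Finset.sum_singleton] at hMtr ⊢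
      change _ = (u * w) () ()
      rw [hu]
      exact eq_neg_of_add_eq_zero_left hMtr
    by_cases hk : ∃ k : {x // x ≠ j}, ⟨i, hij⟩ ≠ k
    · obtain ⟨k, hk⟩ := hk
      obtain ⟨u, hu, hu'⟩ := exists_mul_eq_and_sub_mul_ne_smul_one B hw hk (-a () ())
      refine hconj u hu (ih hu' (htr' u hu) ?_)
      simp [hn]
    · push Not at hk
      let u : Matrix Unit {x // x ≠ j} K := Matrix.of fun _ _ => -a () () / w ⟨i, hij⟩ ()
      have huniv : (Finset.univ : Finset {x // x ≠ j}) = {⟨i, hij⟩} := by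
        ext x
        simp [← hk x]
      have hu : (u * w) () () = -a () () := by
        simp [Matrix.mul_apply, huniv, u, hw]
      refine hconj u hu ⟨1, 1, by simp, by simp, fun x => ?_⟩
      have := htr' u hu
      simp only [Matrix.trace, huniv, Finset.sum_singleton, Matrix.diag_apply] at this
      rw [Matrix.one_mul, Matrix.mul_one, ← hk x, this]

end Hollow

section Jordan

open Polynomial

variable {K : Type*} [Field K]

theorem exists_basis_quotient_X_sub_C_pow (a : K) (e : ℕ) :
    ∃ b : Module.Basis (Fin e) K (K[X] ⧸ Submodule.span K[X] {(X - C a) ^ e}),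
      ∀ j, b j = Submodule.Quotient.mk ((X - C a) ^ (j : ℕ)) := by
  let c : Fin e → K[X] ⧸ Submodule.span K[X] {(X - C a) ^ e} := fun j =>
    Submodule.Quotient.mk ((X - C a) ^ (j : ℕ))
  have hfin : Module.finrank K (K[X] ⧸ Submodule.span K[X] {(X - C a) ^ e}) = e := by
    have := finrank_quotient_span_eq_natDegree (f := (X - C a) ^ e)
    simpa using this
  have hspan : ⊤ ≤ Submodule.span K (Set.range c) := by
    rintro q -
    obtain ⟨q, rfl⟩ := Submodule.Quotient.mk_surjective _ q
    rw [← sum_taylor_eq q a, Polynomial.sum_def, ← Submodule.mkQ_apply, map_sum]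
    refine Submodule.sum_mem _ fun j _ => ?_
    rw [← smul_eq_C_mul, ← LinearMap.restrictScalars_apply K, map_smul]
    refine Submodule.smul_mem _ _ ?_
    rw [LinearMap.restrictScalars_apply, Submodule.mkQ_apply]
    by_cases hj : j < e
    · exact Submodule.subset_span ⟨⟨j, hj⟩, rfl⟩
    · rw [(Submodule.Quotient.mk_eq_zero _).2]
      · exact Submodule.zero_mem _
      · exact Ideal.mem_span_singleton.2 (pow_dvd_pow _ (not_lt.1 hj))
  exact ⟨basisOfTopLeSpanOfCardEqFinrank c hspan (by simp [hfin]), by simp [c]⟩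

theorem exists_equiv_fin_sigma_succ {ι : Type*} [Finite ι] (e : ι → ℕ) :
    ∃ (N : ℕ) (σ : (Σ i, Fin (e i)) ≃ Fin N),
      ∀ i (j : Fin (e i)) (h : (j : ℕ) + 1 < e i), (σ ⟨i, ⟨j + 1, h⟩⟩ : ℕ) = σ ⟨i, j⟩ + 1 := by
  obtain ⟨m, ⟨τ⟩⟩ := Finite.exists_equiv_fin ι
  refine ⟨_, (Equiv.sigmaCongrLeft (β := fun i => Fin (e i)) τ.symm).symm.trans
    (finSigmaFinEquiv (n := fun i => e (τ.symm i))), fun i j h => ?_⟩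
  obtain ⟨i, rfl⟩ := τ.symm.surjective i
  have key : ∀ j : Fin (e (τ.symm i)),
      (Equiv.sigmaCongrLeft (β := fun i => Fin (e i)) τ.symm).symm ⟨τ.symm i, j⟩ = ⟨i, j⟩ := by
    intro j
    rw [Equiv.symm_apply_eq]
    rfl
  rw [Equiv.trans_apply, Equiv.trans_apply, key, key, finSigmaFinEquiv_apply,
    finSigmaFinEquiv_apply, add_assoc]

theorem exists_basis_quotient_irreducible_pow [IsAlgClosed K] {p : K[X]} (hp : Irreducible p)
    (e : ℕ) :
    ∃ (a : K) (b : Module.Basis (Fin e) K (K[X] ⧸ Submodule.span K[X] {p ^ e})),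
      ∀ j, (X : K[X]) • b j = a • b j + if h : (j : ℕ) + 1 < e then b ⟨j + 1, h⟩ else 0 := by
  obtain ⟨a, ha⟩ := IsAlgClosed.exists_root p
    (IsAlgClosed.degree_eq_one_of_irreducible K hp ▸ one_ne_zero)
  have hass : Associated (X - C a) p :=
    (irreducible_X_sub_C a).associated_of_dvd hp (dvd_iff_isRoot.2 ha)
  have hspan : Submodule.span K[X] {p ^ e} = Submodule.span K[X] {(X - C a) ^ e} :=
    (Ideal.span_singleton_eq_span_singleton.2 (hass.pow_pow (n := e))).symm
  rw [hspan]
  obtain ⟨b, hb⟩ := exists_basis_quotient_X_sub_C_pow a e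
  refine ⟨a, b, fun j => ?_⟩
  have hsucc : (if h : (j : ℕ) + 1 < e then b ⟨j + 1, h⟩ else 0) =
      Submodule.Quotient.mk ((X - C a) ^ ((j : ℕ) + 1)) := by
    split_ifs with h
    · rw [hb]
    · refine ((Submodule.Quotient.mk_eq_zero _).2 ?_).symm
      exact Ideal.mem_span_singleton.2 (pow_dvd_pow _ (not_lt.1 h))
  rw [hsucc, hb, ← Submodule.Quotient.mk_smul, ← Submodule.Quotient.mk_smul,
    ← Submodule.Quotient.mk_add]
  congr 1
  rw [smul_eq_mul, smul_eq_C_mul]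
  ring

theorem exists_basis_apply_mem_span_pair_succ [IsAlgClosed K] {V : Type*} [AddCommGroup V]
    [Module K V] [FiniteDimensional K V] (f : Module.End K V) :
    ∃ (N : ℕ) (b : Module.Basis (Fin N) K V), ∀ k l : Fin N, k ≠ l → (l : ℕ) ≠ k + 1 →
      b.repr (f (b k)) l = 0 := by
  obtain ⟨ι, _, p, hp, e, ⟨φ⟩⟩ := Module.equiv_directSum_of_isTorsion
    (R := K[X]) (M := Module.AEval' f) (Module.AEval.isTorsion_of_finiteDimensional K V f)
  classical
  choose a B hB using fun i => exists_basis_quotient_irreducible_pow (hp i) (e i)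
  obtain ⟨N, σ, hσ⟩ := exists_equiv_fin_sigma_succ e
  let D : Module.Basis (Σ i, Fin (e i)) K
    (DirectSum ι fun i => K[X] ⧸ Submodule.span K[X] {p i ^ e i}) := DFinsupp.basis B
  have hD : ∀ i j, D ⟨i, j⟩ = DirectSum.lof K[X] ι _ i (B i j) := by
    intro i j
    rw [Module.Basis.apply_eq_iff]
    change (sigmaFinsuppLequivDFinsupp K).symm (DFinsupp.mapRange.linearEquiv (fun i => (B i).repr)
      (DFinsupp.single i (B i j))) = _
    rw [LinearEquiv.symm_apply_eq, DFinsupp.mapRange.linearEquiv_apply, DFinsupp.mapRange_single,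
      Module.Basis.repr_self, sigmaFinsuppLequivDFinsupp_apply]
    exact (sigmaFinsuppEquivDFinsupp_single (⟨i, j⟩ : Σ i, Fin (e i)) (1 : K)).symm
  let ψ : V ≃ₗ[K] (DirectSum ι fun i => K[X] ⧸ Submodule.span K[X] {p i ^ e i}) :=
    (Module.AEval'.of f).trans (φ.restrictScalars K)
  have hψ : ∀ v, ψ (f v) = (X : K[X]) • ψ v := by
    intro v
    change φ (Module.AEval'.of f (f v)) = (X : K[X]) • φ (Module.AEval'.of f v)
    rw [← map_smul, Module.AEval'.X_smul_of]
  have hX : ∀ i j, (X : K[X]) • D ⟨i, j⟩ =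
      a i • D ⟨i, j⟩ + if h : (j : ℕ) + 1 < e i then D ⟨i, ⟨j + 1, h⟩⟩ else 0 := by
    intro i j
    have hsucc : (if h : (j : ℕ) + 1 < e i then D ⟨i, ⟨j + 1, h⟩⟩ else 0) =
        DirectSum.lof K[X] ι _ i (if h : (j : ℕ) + 1 < e i then B i ⟨j + 1, h⟩ else 0) := by
      split_ifs <;> simp [hD]
    rw [hsucc, hD, ← map_smul, hB, map_add]
    refine congrArg (· + _) ?_
    exact DFinsupp.single_smul (i := i)
      (β := fun i => K[X] ⧸ Submodule.span K[X] {p i ^ e i}) (a i) (B i j)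
  refine ⟨N, (D.map ψ.symm).reindex σ, fun k l hkl hl => ?_⟩
  obtain ⟨⟨i, j⟩, rfl⟩ := σ.surjective k
  obtain ⟨q, rfl⟩ := σ.surjective l
  have hq : ⟨i, j⟩ ≠ q := fun h => hkl (congrArg σ h)
  rw [Module.Basis.repr_reindex_apply]
  simp only [Module.Basis.coe_reindex, Function.comp_apply, Equiv.symm_apply_apply,
    Module.Basis.map_apply, Module.Basis.map_repr, LinearEquiv.trans_apply, hψ,
    LinearEquiv.symm_symm,
    LinearEquiv.apply_symm_apply, hX]
  rw [map_add, map_smul, Module.Basis.repr_self, Finsupp.add_apply, Finsupp.smul_apply,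
    Finsupp.single_eq_of_ne hq.symm, smul_zero, zero_add]
  split_ifs with h
  · rw [Module.Basis.repr_self, Finsupp.single_eq_of_ne]
    rintro rfl
    exact hl (hσ i j h)
  · simp

theorem Matrix.exists_conj_cyclic_bidiagonal [IsAlgClosed K] {n : ℕ} [NeZero n]
    (T : Matrix (ZMod n) (ZMod n) K) :
    ∃ P Q : Matrix (ZMod n) (ZMod n) K, P * Q = 1 ∧ Q * P = 1 ∧
      ∀ i j, j ≠ i → j ≠ i + 1 → (P * T * Q) i j = 0 := by
  obtain ⟨N, b, hb⟩ := exists_basis_apply_mem_span_pair_succ (Matrix.toLin' T.transpose)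
  obtain rfl : N = n := by
    have := Module.finrank_eq_card_basis b
    simpa using this.symm
  let c := Pi.basisFun K (ZMod N)
  let d := b.reindex (ZMod.finEquiv N).toEquiv
  refine ⟨(c.toMatrix d).transpose, (d.toMatrix c).transpose, ?_, ?_, fun i j hi hj => ?_⟩
  · rw [← Matrix.transpose_mul, Module.Basis.toMatrix_mul_toMatrix_flip, Matrix.transpose_one]
  · rw [← Matrix.transpose_mul, Module.Basis.toMatrix_mul_toMatrix_flip, Matrix.transpose_one]
  have key := basis_toMatrix_mul_linearMap_toMatrix_mul_basis_toMatrix d c d c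
    (Matrix.toLin' T.transpose)
  have hc : LinearMap.toMatrix c c (Matrix.toLin' T.transpose) = T.transpose :=
    LinearMap.toMatrix'_toLin' _
  rw [hc] at key
  have key' := congrArg (fun M => M.transpose i j) key
  simp only [Matrix.transpose_mul, Matrix.transpose_transpose] at key'
  rw [Matrix.mul_assoc, key', Matrix.transpose_apply, LinearMap.toMatrix_apply]
  obtain ⟨i, rfl⟩ := (ZMod.finEquiv N).surjective i
  obtain ⟨j, rfl⟩ := (ZMod.finEquiv N).surjective j
  have : d (ZMod.finEquiv N i) = b i := by simp [d]
  rw [this, Module.Basis.repr_reindex_apply]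
  have : (ZMod.finEquiv N).toEquiv.symm (ZMod.finEquiv N j) = j := by simp
  rw [this]
  refine hb _ _ (fun h => hi (by rw [h])) (fun h => hj ?_)
  rw [← map_one (ZMod.finEquiv N), ← map_add]
  congr 1
  apply Fin.ext
  rw [Fin.val_add, h, Fin.val_one', Nat.add_mod_mod, Nat.mod_eq_of_lt (h ▸ j.2)]

end Jordan

section DoubleCommutator

open Matrix

variable {K : Type*} [Field K]

theorem cyclicShift_mul_diagonal_mul_transpose {n : ℕ} [NeZero n] (v : ZMod n → K) :
    cyclicShift n K * diagonal v * (cyclicShift n K).transpose = diagonal fun i => v (i + 1) := by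
  have h : cyclicShift n K * diagonal v = (diagonal fun i => v (i + 1)) * cyclicShift n K := by
    ext i j
    rw [cyclicShift_mul_apply, mul_cyclicShift_apply, diagonal_apply, diagonal_apply]
    simp only [eq_sub_iff_add_eq]
  rw [h, Matrix.mul_assoc, cyclicShift_mul_transpose, Matrix.mul_one]

theorem exists_second_difference_eq {n : ℕ} (hn : (n : K) = 0) (h2 : (2 : K) ≠ 0) (t : K) :
    ∃ v : ZMod n → K, ∀ i, v (i + 1 + 1) - v (i + 1) - (v (i + 1) - v i) = t := by
  obtain ⟨p, _⟩ := CharP.exists K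
  let c := ZMod.castHom ((CharP.cast_eq_zero_iff K p n).1 hn) K
  refine ⟨fun i => t / 2 * c i ^ 2, fun i => ?_⟩
  simp only [map_add, map_one]
  field_simp
  ring

theorem Matrix.exists_smul_one_eq_double_commutator {n : ℕ} [NeZero n] (hn : (n : K) = 0)
    (h2 : (2 : K) ≠ 0) (t : K) :
    ∃ x y : Matrix (ZMod n) (ZMod n) K,
      t • (1 : Matrix (ZMod n) (ZMod n) K) = x * (x * y - y * x) - (x * y - y * x) * x := by
  obtain ⟨v, hv⟩ := exists_second_difference_eq hn h2 t
  set S := cyclicShift n K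
  set R := S.transpose
  have hSR : S * R = 1 := cyclicShift_mul_transpose
  have hRS : R * S = 1 := cyclicShift_transpose_mul
  have hd : ∀ w, S * diagonal w * R = diagonal fun i => w (i + 1) :=
    cyclicShift_mul_diagonal_mul_transpose
  have hcomm : ∀ D A : Matrix (ZMod n) (ZMod n) K,
      S * (D * R * A) - D * R * A * S = S * D * R * A - D * (R * A * S) := by
    intro D A
    simp only [Matrix.mul_assoc]
  refine ⟨S, diagonal v * R * R, ?_⟩
  rw [hcomm, Matrix.mul_assoc R, hRS, Matrix.mul_one, hd, ← Matrix.sub_mul, diagonal_sub]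
  have := hcomm (diagonal fun i => v (i + 1) - v i) 1
  rw [Matrix.mul_one, Matrix.mul_one, Matrix.mul_one, hRS, Matrix.mul_one] at this
  rw [this, hd, diagonal_sub, smul_one_eq_diagonal]
  simp only [hv]

theorem Matrix.exists_eq_double_commutator_of_trace_eq_zero [Infinite K] {n : ℕ} [NeZero n]
    (h2 : (2 : K) ≠ 0) {T : Matrix (ZMod n) (ZMod n) K} (hT : T.trace = 0) :
    ∃ x y : Matrix (ZMod n) (ZMod n) K,
      T = x * (x * y - y * x) - (x * y - y * x) * x := by
  by_cases hsc : ∀ c : K, T ≠ c • 1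
  · obtain ⟨P, Q, hPQ, hQP, hd⟩ := similarToHollow_of_trace_eq_zero hsc hT
    obtain ⟨d, hdinj⟩ := exists_injective_of_infinite (ZMod n) K
    obtain ⟨w, hw⟩ := exists_eq_diagonal_commutator hdinj _ hd
    obtain ⟨y, hy⟩ := exists_eq_diagonal_commutator hdinj (w - diagonal (fun i => w i i))
      (fun i => by simp)
    set D := diagonal d
    have hcomm : ∀ A B : Matrix (ZMod n) (ZMod n) K,
        Q * A * P * (Q * B * P) = Q * (A * B) * P := by
      intro A B
      rw [← Matrix.mul_assoc (Q * A * P), ← Matrix.mul_assoc (Q * A * P), Matrix.mul_assoc _ P,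
        hPQ, Matrix.mul_one, Matrix.mul_assoc Q]
    have hdiag : D * diagonal (fun i => w i i) = diagonal (fun i => w i i) * D := by
      simp only [D, diagonal_mul_diagonal, mul_comm]
    refine ⟨Q * D * P, Q * y * P, ?_⟩
    simp only [hcomm, ← Matrix.sub_mul, ← Matrix.mul_sub, ← hy]
    rw [Matrix.mul_sub D, Matrix.sub_mul _ _ D, hdiag, sub_sub_sub_cancel_right, ← hw]
    simp only [← Matrix.mul_assoc, hQP, Matrix.one_mul]
    rw [Matrix.mul_assoc, hQP, Matrix.mul_one]
  · push Not at hsc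
    obtain ⟨t, rfl⟩ := hsc
    rw [trace_smul, trace_one, ZMod.card, smul_eq_mul, mul_eq_zero] at hT
    rcases hT with rfl | hn
    · exact ⟨0, 0, by simp⟩
    · exact exists_smul_one_eq_double_commutator hn h2 t

end DoubleCommutator

section CubicImage

open Matrix

variable {K : Type*} [Field K] {n : ℕ} [NeZero n]

theorem cubicEval_conj {ι : Type*} [Fintype ι] [DecidableEq ι] (l1 l2 l3 m1 m2 m3 : K)
    {P Q : Matrix ι ι K} (hQP : Q * P = 1) (a b c : Matrix ι ι K) :
    cubicEval l1 l2 l3 m1 m2 m3 (P * a * Q) (P * b * Q) (P * c * Q) =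
      P * cubicEval l1 l2 l3 m1 m2 m3 a b c * Q := by
  have hmul : ∀ A B : Matrix ι ι K, P * A * Q * (P * B * Q) = P * (A * B) * Q := by
    intro A B
    rw [← Matrix.mul_assoc (P * A * Q), ← Matrix.mul_assoc (P * A * Q), Matrix.mul_assoc _ Q,
      hQP, Matrix.mul_one, Matrix.mul_assoc P]
  simp only [cubicEval, hmul, Matrix.mul_add, Matrix.add_mul, Matrix.mul_smul, Matrix.smul_mul]

theorem AttainsBidiagonal.exists_cubicEval_eq [IsAlgClosed K] {l1 l2 l3 m1 m2 m3 : K}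
    (h : AttainsBidiagonal n l1 l2 l3 m1 m2 m3) (T : Matrix (ZMod n) (ZMod n) K) :
    ∃ a b c, T = cubicEval l1 l2 l3 m1 m2 m3 a b c := by
  obtain ⟨P, Q, hPQ, hQP, hT⟩ := T.exists_conj_cyclic_bidiagonal
  obtain ⟨a, b, c, habc⟩ := h _ hT
  refine ⟨Q * a * P, Q * b * P, Q * c * P, ?_⟩
  rw [cubicEval_conj _ _ _ _ _ _ hPQ, ← habc]
  simp only [← Matrix.mul_assoc, hQP, Matrix.one_mul]
  rw [Matrix.mul_assoc, hQP, Matrix.mul_one]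

theorem trace_cubicEval {ι : Type*} [Fintype ι] [DecidableEq ι]
    (l1 l2 l3 m1 m2 m3 : K) (a b c : Matrix ι ι K) :
    (cubicEval l1 l2 l3 m1 m2 m3 a b c).trace =
      (l1 + l2 + l3) * (a * b * c).trace + (m1 + m2 + m3) * (c * b * a).trace := by
  simp only [cubicEval, trace_add, trace_smul, smul_eq_mul]
  rw [trace_mul_cycle b c a, trace_mul_cycle c a b, trace_mul_cycle b c a, trace_mul_cycle a c b,
    trace_mul_cycle b a c]
  ring

theorem exists_cubicEval_eq_of_trace_eq_zero [Infinite K] (h2 : (2 : K) ≠ 0)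
    {l1 l2 l3 m1 m2 m3 : K} (hl : l1 + l2 + l3 = 0) (hm : m1 + m2 + m3 = 0)
    (hne : ¬ (l1 = 0 ∧ l2 = 0 ∧ l3 = 0 ∧ m1 = 0 ∧ m2 = 0 ∧ m3 = 0))
    {T : Matrix (ZMod n) (ZMod n) K} (hT : T.trace = 0) :
    ∃ a b c, T = cubicEval l1 l2 l3 m1 m2 m3 a b c := by
  have hT' : ∀ t : K, (t⁻¹ • T).trace = 0 := fun t => by rw [trace_smul, hT, smul_zero]
  have hdouble : ∀ t : K, t ≠ 0 → ∃ x y : Matrix (ZMod n) (ZMod n) K,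
      T = t • (x * (x * y - y * x) - (x * y - y * x) * x) := by
    intro t ht
    obtain ⟨x, y, h⟩ := exists_eq_double_commutator_of_trace_eq_zero h2 (hT' t)
    exact ⟨x, y, by rw [← h, smul_inv_smul₀ ht]⟩
  have hsingle : ∀ t : K, t ≠ 0 → ∃ x y : Matrix (ZMod n) (ZMod n) K,
      T = t • (x * y - y * x) := fun t ht =>
    let ⟨x, y, h⟩ := hdouble t ht
    ⟨x, x * y - y * x, h⟩
  obtain rfl : l3 = -(l1 + l2) := by linear_combination hl
  obtain rfl : m3 = -(m1 + m2) := by linear_combination hm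
  by_cases h1 : l1 = m1
  · by_cases h3 : l2 = m2
    · subst h1 h3
      by_cases h1 : l1 = 0
      · have h3 : l2 ≠ 0 := fun h3 => hne (by simp [h1, h3])
        obtain ⟨x, y, rfl⟩ := hdouble (-l2) (neg_ne_zero.2 h3)
        refine ⟨x, x, y, ?_⟩
        simp only [cubicEval, Matrix.mul_sub, Matrix.sub_mul, Matrix.mul_assoc]
        module
      · obtain ⟨x, y, rfl⟩ := hdouble (-l1) (neg_ne_zero.2 h1)
        refine ⟨x, y, x, ?_⟩
        simp only [cubicEval, Matrix.mul_sub, Matrix.sub_mul, Matrix.mul_assoc]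
        module
    · obtain ⟨x, y, rfl⟩ := hsingle (m2 - l2) (sub_ne_zero.2 (Ne.symm h3))
      refine ⟨x, y, 1, ?_⟩
      simp only [cubicEval, Matrix.one_mul, Matrix.mul_one]
      module
  · obtain ⟨x, z, rfl⟩ := hsingle (l1 - m1) (sub_ne_zero.2 h1)
    refine ⟨x, 1, z, ?_⟩
    simp only [cubicEval, Matrix.one_mul, Matrix.mul_one]
    module

theorem exists_submodule_eq_range_cubicEval [IsAlgClosed K] (hn : Odd n) (hn4 : 4 ≤ n)
    (h2 : (2 : K) ≠ 0) (h3 : (3 : K) ≠ 0) {l1 l2 l3 m1 m2 m3 : K}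
    (hp1 : l1 ^ n = m1 ^ n → l1 = m1) (hp2 : l2 ^ n = m2 ^ n → l2 = m2)
    (hp3 : l3 ^ n = m3 ^ n → l3 = m3) :
    ∃ V : Submodule K (Matrix (ZMod n) (ZMod n) K),
      ∀ w, w ∈ V ↔ ∃ a b c, w = cubicEval l1 l2 l3 m1 m2 m3 a b c := by
  have := IsAlgClosed.instInfinite (K := K)
  by_cases hs : l1 + l2 + l3 + m1 + m2 + m3 = 0
  · by_cases hl : l1 + l2 + l3 = 0
    · by_cases h0 : l1 = 0 ∧ l2 = 0 ∧ l3 = 0 ∧ m1 = 0 ∧ m2 = 0 ∧ m3 = 0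
      · obtain ⟨rfl, rfl, rfl, rfl, rfl, rfl⟩ := h0
        exact ⟨⊥, fun w => by simp [cubicEval]⟩
      have hm : m1 + m2 + m3 = 0 := by linear_combination hs - hl
      refine ⟨LinearMap.ker (traceLinearMap (ZMod n) K K), fun w => ⟨fun hw =>
        exists_cubicEval_eq_of_trace_eq_zero h2 hl hm h0 hw, ?_⟩⟩
      rintro ⟨a, b, c, rfl⟩
      simp [trace_cubicEval, hl, hm]
    · exact ⟨⊤, fun w => ⟨fun _ => (attainsBidiagonal_of_sum_ne_zero hn hn4 h2 h3 hs hl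
        hp1 hp2 hp3).exists_cubicEval_eq w, fun _ => trivial⟩⟩
  · refine ⟨⊤, fun w => ⟨fun _ => ⟨(l1 + l2 + l3 + m1 + m2 + m3)⁻¹ • w, 1, 1, ?_⟩,
      fun _ => trivial⟩⟩
    simp only [cubicEval, Matrix.one_mul, Matrix.mul_one, ← add_smul]
    rw [smul_inv_smul₀ hs]

end CubicImage

section Exponent

variable {K : Type*} [Field K] {p : ℕ} [Fact p.Prime] [CharP K p]

theorem coprime_orderOf_of_charP {x : K} (hx : orderOf x ≠ 0) : p.Coprime (orderOf x) := by
  refine (Fact.out : p.Prime).coprime_iff_not_dvd.2 fun ⟨e, he⟩ => ?_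
  have hxe : x ^ e = 1 := by
    refine frobenius_inj K p ?_
    rw [frobenius_def, frobenius_def, one_pow, ← pow_mul, mul_comm, ← he, pow_orderOf_eq_one]
  have he0 : 0 < e := Nat.pos_of_ne_zero fun h => hx (by rw [he, h, mul_zero])
  have hle := Nat.le_of_dvd he0 (orderOf_dvd_of_pow_eq_one hxe)
  have := (Fact.out : p.Prime).two_le
  nlinarith

variable (p) in
theorem exists_exponent_pow_eq_pow_imp_eq (l m : K) :
    ∃ k, 1 ≤ k ∧ ∀ n, n ≠ 0 → n.Coprime (p ^ k - 1) → l ^ n = m ^ n → l = m := by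
  by_cases hm : m = 0
  · refine ⟨1, le_rfl, fun n hn _ h => ?_⟩
    rw [hm, zero_pow hn] at h
    rw [hm, eq_zero_of_pow_eq_zero h]
  have hpow : ∀ n, l ^ n = m ^ n → orderOf (l / m) ∣ n := fun n h =>
    orderOf_dvd_of_pow_eq_one (by rw [div_pow, h, div_self (pow_ne_zero n hm)])
  by_cases hord : orderOf (l / m) = 0
  · exact ⟨1, le_rfl, fun n hn _ h => absurd (Nat.eq_zero_of_zero_dvd (hord ▸ hpow n h)) hn⟩
  refine ⟨(orderOf (l / m)).totient, Nat.totient_pos.2 (Nat.pos_of_ne_zero hord),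
    fun n _ hcop h => ?_⟩
  have hdvd : orderOf (l / m) ∣ p ^ (orderOf (l / m)).totient - 1 :=
    (Nat.modEq_iff_dvd' (Nat.one_le_pow _ _ (Fact.out : p.Prime).pos)).1
      (Nat.ModEq.pow_totient (coprime_orderOf_of_charP (p := p) hord)).symm
  have h1 := Nat.eq_one_of_dvd_coprimes hcop (hpow n h) hdvd
  rw [orderOf_eq_one_iff, div_eq_one_iff_eq hm] at h1
  exact h1

theorem Nat.Coprime.pow_sub_one_of_dvd {n p k k' : ℕ} (h : n.Coprime (p ^ k' - 1)) (hk : k ∣ k') :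
    n.Coprime (p ^ k - 1) := by
  obtain ⟨r, rfl⟩ := hk
  refine h.coprime_dvd_right ?_
  simpa [pow_mul] using Nat.sub_dvd_pow_sub_pow (p ^ k) 1 r

end Exponent

theorem map_cubicEval {K A B F : Type*} [CommSemiring K] [Semiring A] [Semiring B] [Algebra K A]
    [Algebra K B] [FunLike F A B] [AlgHomClass F K A B] (φ : F) (l1 l2 l3 m1 m2 m3 : K)
    (a b c : A) :
    φ (cubicEval l1 l2 l3 m1 m2 m3 a b c) = cubicEval l1 l2 l3 m1 m2 m3 (φ a) (φ b) (φ c) := by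
  simp only [cubicEval, map_add, map_smul, map_mul]

/-- Positive characteristic result (Theorem 3.4): over an algebraically closed
field of characteristic `p ≥ 5`, there exists `k ≥ 1` such that the image of a
multilinear polynomial of degree three in `Mₙ(K)` is a vector subspace for
every `n ≥ 4` coprime to `p^k - 1`. -/
theorem image_is_subspace_positive_char
    (K : Type*) [Field K] [IsAlgClosed K] (p : ℕ) [hp : Fact p.Prime]
    [CharP K p] (hp5 : 5 ≤ p) (l1 l2 l3 m1 m2 m3 : K) :
    ∃ k : ℕ, 1 ≤ k ∧ ∀ n : ℕ, 4 ≤ n → Nat.Coprime n (p ^ k - 1) →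
      ∃ V : Submodule K (Matrix (Fin n) (Fin n) K),
        (V : Set (Matrix (Fin n) (Fin n) K)) =
          {w : Matrix (Fin n) (Fin n) K | ∃ a b c : Matrix (Fin n) (Fin n) K,
            w = l1 • (a * b * c) + l2 • (b * c * a) + l3 • (c * a * b)
              + m1 • (c * b * a) + m2 • (a * c * b) + m3 • (b * a * c)} := by
  obtain ⟨k1, hk1, h1⟩ := exists_exponent_pow_eq_pow_imp_eq p l1 m1
  obtain ⟨k2, hk2, h2⟩ := exists_exponent_pow_eq_pow_imp_eq p l2 m2
  obtain ⟨k3, hk3, h3⟩ := exists_exponent_pow_eq_pow_imp_eq p l3 m3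
  have hk : 1 ≤ k1 * k2 * k3 := Nat.mul_pos (Nat.mul_pos hk1 hk2) hk3
  refine ⟨k1 * k2 * k3, hk, fun n hn4 hcop => ?_⟩
  have hn0 : n ≠ 0 := by lia
  have : NeZero n := ⟨hn0⟩
  have hodd : Odd n := by
    by_contra hn
    have hp2 : Odd p := hp.out.odd_of_ne_two (by lia)
    have hdvd : 2 ∣ p ^ (k1 * k2 * k3) - 1 := (Nat.Odd.sub_odd hp2.pow odd_one).two_dvd
    have := Nat.eq_one_of_dvd_coprimes hcop (Nat.not_odd_iff_even.1 hn).two_dvd hdvd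
    lia
  have hcast : ∀ q, q ≠ 0 → q < p → (q : K) ≠ 0 := fun q hq hqp h =>
    absurd (Nat.le_of_dvd (Nat.pos_of_ne_zero hq) ((CharP.cast_eq_zero_iff K p q).1 h)) (by lia)
  obtain ⟨V, hV⟩ := exists_submodule_eq_range_cubicEval (n := n) hodd hn4
    (by exact_mod_cast hcast 2 (by lia) (by lia)) (by exact_mod_cast hcast 3 (by lia) (by lia))
    (h1 n hn0 (hcop.pow_sub_one_of_dvd (Dvd.intro _ (mul_assoc k1 k2 k3).symm)))
    (h2 n hn0 (hcop.pow_sub_one_of_dvd ((Nat.dvd_mul_left k2 k1).mul_right k3)))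
    (h3 n hn0 (hcop.pow_sub_one_of_dvd (Nat.dvd_mul_left k3 (k1 * k2))))
  let φ := Matrix.reindexAlgEquiv K K (ZMod.finEquiv n).toEquiv
  refine ⟨V.comap φ.toLinearMap, Set.ext fun w => ?_⟩
  change φ w ∈ V ↔ ∃ a b c, w = cubicEval l1 l2 l3 m1 m2 m3 a b c
  rw [hV]
  constructor
  · rintro ⟨a, b, c, h⟩
    refine ⟨φ.symm a, φ.symm b, φ.symm c, ?_⟩
    rw [← map_cubicEval, ← h, AlgEquiv.symm_apply_apply]
  · rintro ⟨a, b, c, rfl⟩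
    exact ⟨φ a, φ b, φ c, map_cubicEval φ _ _ _ _ _ _ _ _ _⟩
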